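/- arXiv:1507.01322 — 5 statements merged into one kernel-verified Lean document; each statement's English description precedes it below -/
import Mathlib

section
/- For every real z with 0 ≤ z < 1, the generating functions satisfy U(z) − 1 = F(z) · U(z); equivalently F(z) = (U(z) − 1)/U(z) = (1 + 1/(U(z) − 1))^{−1} whenever U(z) > 1. -/
open MeasureTheory ENNReal

def occursAt (S : List Bool) (ω : ℕ → Bool) (n : ℕ) : Prop :=
  S.length ≤ n ∧ ∀ j < S.length, ω (n - S.length + j) = S.getD j false

noncomputable def firstOcc (S : List Bool) (ω : ℕ → Bool) : ℕ∞ :=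
  ⨅ (n : ℕ) (_ : occursAt S ω n), (n : ℕ∞)

noncomputable def renewal (S : List Bool) : ℕ → (ℕ → Bool) → ℕ∞
  | 0, _ => 0
  | m + 1, ω =>
      renewal S m ω + firstOcc S (fun i => ω (i + (renewal S m ω).toNat))

noncomputable def u (μ : Measure (ℕ → Bool)) (S : List Bool) (n : ℕ) : ℝ≥0∞ :=
  if n = 0 then 1 else μ {ω | ∃ m, 1 ≤ m ∧ renewal S m ω = (n : ℕ∞)}

noncomputable def f (μ : Measure (ℕ → Bool)) (S : List Bool) (n : ℕ) : ℝ≥0∞ :=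
  μ {ω | firstOcc S ω = (n : ℕ∞)}

/-- The probability generating function `F(z) = ∑ f_n zⁿ`. -/
noncomputable def F (μ : Measure (ℕ → Bool)) (S : List Bool) (z : ℝ) : ℝ :=
  ∑' n : ℕ, (f μ S n).toReal * z ^ n

/-- The generating function `U(z) = ∑ u_n zⁿ`. -/
noncomputable def U (μ : Measure (ℕ → Bool)) (S : List Bool) (z : ℝ) : ℝ :=
  ∑' n : ℕ, (u μ S n).toReal * z ^ n

theorem firstOcc_eq_natCast_iff {S : List Bool} {ω : ℕ → Bool} {n : ℕ} :
    firstOcc S ω = (n : ℕ∞) ↔ occursAt S ω n ∧ ∀ j < n, ¬ occursAt S ω j := by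
  constructor
  · intro h
    have lower : ∀ j < n, ¬ occursAt S ω j := by
      intro j hj hoc
      have hle : firstOcc S ω ≤ (j : ℕ∞) := iInf₂_le j hoc
      rw [h] at hle
      exact absurd (Nat.cast_le.mp hle) (by omega)
    refine ⟨by_contra fun hn => ?_, lower⟩
    have hle : ((n + 1 : ℕ) : ℕ∞) ≤ firstOcc S ω := by
      refine le_iInf₂ fun j hj => Nat.cast_le.mpr ?_
      by_contra! hlt
      rcases Nat.lt_succ_iff_lt_or_eq.mp hlt with h' | rfl
      · exact lower j h' hj
      · exact hn hj
    rw [h] at hle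
    exact absurd (Nat.cast_le.mp hle) (by omega)
  · rintro ⟨hn, lower⟩
    refine le_antisymm (iInf₂_le n hn) (le_iInf₂ fun j hj => Nat.cast_le.mpr ?_)
    by_contra! hlt
    exact lower j hlt hj

theorem occursAt_congr {S : List Bool} {ω ω' : ℕ → Bool} {n : ℕ}
    (h : ∀ i < n, ω i = ω' i) : occursAt S ω n ↔ occursAt S ω' n := by
  unfold occursAt
  refine and_congr_right fun hn => forall₂_congr fun j hj => ?_
  rw [h _ (by omega)]

theorem firstOcc_eq_congr {S : List Bool} {ω ω' : ℕ → Bool} {n : ℕ}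
    (h : ∀ i < n, ω i = ω' i) :
    firstOcc S ω = (n : ℕ∞) ↔ firstOcc S ω' = (n : ℕ∞) := by
  rw [firstOcc_eq_natCast_iff, firstOcc_eq_natCast_iff, occursAt_congr h]
  refine and_congr_right fun _ => forall₂_congr fun j hj => ?_
  rw [occursAt_congr fun i hi => h i (hi.trans hj)]

theorem firstOcc_ne_zero {S : List Bool} (hS : S ≠ []) (ω : ℕ → Bool) : firstOcc S ω ≠ 0 := by
  intro h
  have hlen := (firstOcc_eq_natCast_iff (n := 0).mp (by simpa using h)).1.1
  exact hS (List.length_eq_zero_iff.mp (by omega))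

theorem renewal_succ_of_firstOcc_eq {S : List Bool} {ω : ℕ → Bool} {k : ℕ}
    (h : firstOcc S ω = (k : ℕ∞)) (m : ℕ) :
    renewal S (m + 1) ω = k + renewal S m (fun i => ω (i + k)) := by
  induction m with
  | zero => simp [renewal, h]
  | succ m ih =>
    rw [renewal, ih, renewal]
    cases hr : renewal S m (fun i => ω (i + k)) with
    | top => simp
    | coe r =>
      have hto : ((k : ℕ∞) + (r : ℕ∞)).toNat = k + r := by
        rw [← Nat.cast_add, ENat.toNat_natCast]
      rw [hto, ENat.toNat_natCast, add_assoc]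
      simp only [add_assoc, add_comm k r]

theorem renewal_succ_of_firstOcc_eq_top {S : List Bool} {ω : ℕ → Bool}
    (h : firstOcc S ω = ⊤) (m : ℕ) : renewal S (m + 1) ω = ⊤ := by
  induction m with
  | zero => simp [renewal, h]
  | succ m ih => rw [renewal, ih, top_add]

/-- The event that trial `n` is a renewal epoch, where `0` always counts as one. -/
def renewalEvent (S : List Bool) (n : ℕ) : Set (ℕ → Bool) :=
  {ω | ∃ m, renewal S m ω = (n : ℕ∞)}

theorem renewalEvent_zero (S : List Bool) : renewalEvent S 0 = Set.univ :=
  Set.eq_univ_of_forall fun _ => ⟨0, rfl⟩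

theorem u_eq_measure_renewalEvent (μ : Measure (ℕ → Bool)) [IsProbabilityMeasure μ]
    (S : List Bool) (n : ℕ) : u μ S n = μ (renewalEvent S n) := by
  unfold u
  split_ifs with hn
  · rw [hn, renewalEvent_zero, measure_univ]
  · congr 1
    ext ω
    refine ⟨fun ⟨m, _, hm⟩ => ⟨m, hm⟩, fun ⟨m, hm⟩ => ⟨m, ?_, hm⟩⟩
    rcases m with _ | m
    · exact absurd (Nat.cast_injective (R := ℕ∞) (by simpa [renewal] using hm)) (Ne.symm hn)
    · omega

theorem renewal_eq_of_agree {S : List Bool} {m n : ℕ} {ω ω' : ℕ → Bool}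
    (h : ∀ i < n, ω i = ω' i) (hm : renewal S m ω = (n : ℕ∞)) :
    renewal S m ω' = (n : ℕ∞) := by
  induction m generalizing n ω ω' with
  | zero => exact hm
  | succ m ih =>
    cases hk : firstOcc S ω with
    | top => simp [renewal_succ_of_firstOcc_eq_top hk] at hm
    | coe k =>
      rw [renewal_succ_of_firstOcc_eq hk] at hm
      cases hr : renewal S m (fun i => ω (i + k)) with
      | top => simp [hr] at hm
      | coe r =>
        rw [hr] at hm
        have hkr : k + r = n := by exact_mod_cast hm
        rw [firstOcc_eq_congr fun i hi => h i (by omega)] at hk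
        rw [renewal_succ_of_firstOcc_eq hk,
          ih (ω' := fun i => ω' (i + k)) (fun i hi => h (i + k) (by omega)) hr, hm]

theorem dependsOn_renewalEvent (S : List Bool) (n : ℕ) :
    DependsOn (· ∈ renewalEvent S n) (Set.Iio n) := fun _ _ h =>
  propext ⟨fun ⟨m, hm⟩ => ⟨m, renewal_eq_of_agree h hm⟩,
    fun ⟨m, hm⟩ => ⟨m, renewal_eq_of_agree (fun i hi => (h i hi).symm) hm⟩⟩

theorem dependsOn_firstOcc_eq (S : List Bool) (n : ℕ) :
    DependsOn (· ∈ {ω | firstOcc S ω = (n : ℕ∞)}) (Set.Iio n) := fun _ _ h =>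
  propext (firstOcc_eq_congr h)

theorem renewalEvent_eq_biUnion {S : List Bool} {n : ℕ} (hn : n ≠ 0) :
    renewalEvent S n = ⋃ x ∈ Finset.HasAntidiagonal.antidiagonal n,
      {ω | firstOcc S ω = (x.1 : ℕ∞)} ∩ (fun ω i => ω (i + x.1)) ⁻¹' renewalEvent S x.2 := by
  ext ω
  simp only [Set.mem_iUnion, Finset.HasAntidiagonal.mem_antidiagonal, exists_prop]
  constructor
  · rintro ⟨m, hm⟩
    rcases m with _ | m
    · exact absurd (Nat.cast_injective (R := ℕ∞) (by simpa [renewal] using hm)) (Ne.symm hn)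
    cases hk : firstOcc S ω with
    | top => simp [renewal_succ_of_firstOcc_eq_top hk] at hm
    | coe k =>
      rw [renewal_succ_of_firstOcc_eq hk] at hm
      cases hr : renewal S m (fun i => ω (i + k)) with
      | top => simp [hr] at hm
      | coe r =>
        rw [hr] at hm
        exact ⟨(k, r), by exact_mod_cast hm, hk, m, hr⟩
  · rintro ⟨⟨k, r⟩, hkr, hk, m, hm⟩
    refine ⟨m + 1, ?_⟩
    rw [renewal_succ_of_firstOcc_eq hk, hm, ← hkr]
    push_cast
    rfl

/-- Extend a finite word by `false`. -/
def extendWord {n : ℕ} (b : Fin n → Bool) (i : ℕ) : Bool :=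
  if h : i < n then b ⟨i, h⟩ else false

theorem extendWord_val {n : ℕ} (b : Fin n → Bool) (i : Fin n) : extendWord b i = b i := by
  simp [extendWord]

theorem eq_preimage_of_dependsOn {A : Set (ℕ → Bool)} {n : ℕ}
    (hA : DependsOn (· ∈ A) (Set.Iio n)) :
    A = (fun ω (i : Fin n) => ω i) ⁻¹' {b | extendWord b ∈ A} := by
  ext ω
  refine iff_of_eq (hA fun i hi => ?_)
  exact (extendWord_val (fun i : Fin n => ω i) ⟨i, hi⟩).symm

theorem measurableSet_of_dependsOn {A : Set (ℕ → Bool)} {n : ℕ}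
    (hA : DependsOn (· ∈ A) (Set.Iio n)) : MeasurableSet A := by
  rw [eq_preimage_of_dependsOn hA]
  exact measurable_pi_lambda _ (fun i => measurable_pi_apply _) MeasurableSet.of_discrete

section Product

variable {μ : Measure (ℕ → Bool)} {w : Bool → ℝ≥0∞}

open Classical in
theorem measure_eq_sum_words
    (hμ : ∀ (n : ℕ) (b : ℕ → Bool), μ {ω | ∀ i < n, ω i = b i} = ∏ i ∈ Finset.range n, w (b i))
    {A : Set (ℕ → Bool)} {n : ℕ} (hA : DependsOn (· ∈ A) (Set.Iio n)) :
    μ A = ∑ b : Fin n → Bool, if extendWord b ∈ A then ∏ i, w (b i) else 0 := by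
  have hmeas : Measurable fun (ω : ℕ → Bool) (i : Fin n) => ω i :=
    measurable_pi_lambda _ fun i => measurable_pi_apply _
  have hpre := sum_measure_preimage_singleton (μ := μ)
    (Finset.univ.filter fun b : Fin n → Bool => extendWord b ∈ A)
    (f := fun (ω : ℕ → Bool) (i : Fin n) => ω i) fun b _ => hmeas MeasurableSet.of_discrete
  rw [Finset.coe_filter_univ, ← eq_preimage_of_dependsOn hA] at hpre
  rw [← hpre, Finset.sum_filter]
  refine Finset.sum_congr rfl fun b _ => ?_
  congr 1
  have hcyl : (fun (ω : ℕ → Bool) (i : Fin n) => ω i) ⁻¹' {b}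
      = {ω | ∀ i < n, ω i = extendWord b i} := by
    ext ω
    simp only [Set.mem_preimage, Set.mem_singleton_iff, funext_iff, Set.mem_ofPred_eq]
    exact ⟨fun h i hi => (h ⟨i, hi⟩).trans (extendWord_val b ⟨i, hi⟩).symm,
      fun h i => (h i i.2).trans (extendWord_val b i)⟩
  rw [hcyl, hμ, ← Fin.prod_univ_eq_prod_range (fun i => w (extendWord b i))]
  simp only [extendWord_val]

/-- The first `k` coordinates are independent of the following ones. -/
theorem measure_inter_shift
    (hμ : ∀ (n : ℕ) (b : ℕ → Bool), μ {ω | ∀ i < n, ω i = b i} = ∏ i ∈ Finset.range n, w (b i))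
    {A B : Set (ℕ → Bool)} {k r : ℕ} (hB : DependsOn (· ∈ B) (Set.Iio k))
    (hA : DependsOn (· ∈ A) (Set.Iio r)) :
    μ (B ∩ (fun ω i => ω (i + k)) ⁻¹' A) = μ B * μ A := by
  classical
  have hBA : DependsOn (· ∈ B ∩ (fun ω i => ω (i + k)) ⁻¹' A) (Set.Iio (k + r)) := by
    intro x y h
    have h₁ : (x ∈ B) = (y ∈ B) := hB fun i hi => h i (by simp at hi ⊢; omega)
    have h₂ : ((fun i => x (i + k)) ∈ A) = ((fun i => y (i + k)) ∈ A) :=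
      hA fun i hi => h (i + k) (by simp at hi ⊢; omega)
    simp only [Set.mem_inter_iff, Set.mem_preimage, h₁, h₂]
  rw [measure_eq_sum_words hμ hBA, measure_eq_sum_words hμ hB, measure_eq_sum_words hμ hA,
    Finset.sum_mul_sum, ← Fintype.sum_prod_type', ← (Fin.appendEquiv k r).sum_comp]
  refine Finset.sum_congr rfl fun x _ => ?_
  obtain ⟨b, a⟩ := x
  have h₁ : (extendWord (Fin.append b a) ∈ B) = (extendWord b ∈ B) := hB fun i hi => by
    have := extendWord_val (Fin.append b a) (Fin.castAdd r ⟨i, hi⟩)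
    rw [Fin.append_left] at this
    exact this.trans (extendWord_val b ⟨i, hi⟩).symm
  have h₂ : ((fun i => extendWord (Fin.append b a) (i + k)) ∈ A) = (extendWord a ∈ A) :=
    hA fun i hi => by
      have := extendWord_val (Fin.append b a) (Fin.natAdd k ⟨i, hi⟩)
      rw [Fin.append_right] at this
      simp only [Fin.val_natAdd] at this
      rw [add_comm i k]
      exact this.trans (extendWord_val a ⟨i, hi⟩).symm
  simp only [Fin.appendEquiv, Equiv.coe_fn_mk, Set.mem_inter_iff, Set.mem_preimage, h₁, h₂,
    Fin.prod_univ_add, Fin.append_left, Fin.append_right]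
  split_ifs <;> simp_all

theorem u_eq_sum_antidiagonal [IsProbabilityMeasure μ]
    (hμ : ∀ (n : ℕ) (b : ℕ → Bool), μ {ω | ∀ i < n, ω i = b i} = ∏ i ∈ Finset.range n, w (b i))
    (S : List Bool) {n : ℕ} (hn : n ≠ 0) :
    u μ S n = ∑ x ∈ Finset.HasAntidiagonal.antidiagonal n, f μ S x.1 * u μ S x.2 := by
  have hmeas : ∀ x : ℕ × ℕ, MeasurableSet ({ω | firstOcc S ω = (x.1 : ℕ∞)} ∩
      (fun (ω : ℕ → Bool) i => ω (i + x.1)) ⁻¹' renewalEvent S x.2) := fun x =>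
    (measurableSet_of_dependsOn (dependsOn_firstOcc_eq S x.1)).inter
      (measurable_pi_lambda _ (fun i => measurable_pi_apply _)
        (measurableSet_of_dependsOn (dependsOn_renewalEvent S x.2)))
  rw [u_eq_measure_renewalEvent, renewalEvent_eq_biUnion hn, measure_biUnion_finset _
    fun x _ => hmeas x]
  · refine Finset.sum_congr rfl fun x _ => ?_
    rw [measure_inter_shift hμ (dependsOn_firstOcc_eq S x.1) (dependsOn_renewalEvent S x.2),
      u_eq_measure_renewalEvent, f]
  · intro x hx y hy hxy
    refine Set.disjoint_left.mpr fun ω hωx hωy => hxy ?_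
    have hfst : x.1 = y.1 := Nat.cast_injective (R := ℕ∞) (hωx.1.symm.trans hωy.1)
    simp only [Finset.mem_coe, Finset.HasAntidiagonal.mem_antidiagonal] at hx hy
    exact Prod.ext hfst (by omega)

end Product

theorem f_zero (μ : Measure (ℕ → Bool)) {S : List Bool} (hS : S ≠ []) : f μ S 0 = 0 := by
  simp [f, firstOcc_ne_zero hS]

theorem summable_toReal_mul_pow {a : ℕ → ℝ≥0∞} (ha : ∀ n, a n ≤ 1) {z : ℝ} (hz0 : 0 ≤ z)
    (hz1 : z < 1) : Summable fun n => (a n).toReal * z ^ n :=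
  (summable_geometric_of_lt_one hz0 hz1).of_nonneg_of_le (fun n => by positivity) fun n =>
    mul_le_of_le_one_left (pow_nonneg hz0 n) (ENNReal.toReal_le_of_le_ofReal one_pos.le
      (by simpa using ha n))

theorem stmt1 (p : ℝ) (hp0 : 0 < p) (hp1 : p < 1)
    (μ : Measure (ℕ → Bool)) [IsProbabilityMeasure μ]
    (hμ : ∀ (n : ℕ) (b : ℕ → Bool),
      μ {ω | ∀ i < n, ω i = b i}
        = ∏ i ∈ Finset.range n, (if b i then ENNReal.ofReal p else ENNReal.ofReal (1 - p)))
    (S : List Bool) (hS : S ≠ [])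
    (z : ℝ) (hz0 : 0 ≤ z) (hz1 : z < 1) :
    U μ S z - 1 = F μ S z * U μ S z ∧
    (1 < U μ S z → F μ S z = (U μ S z - 1) / U μ S z) := by
  have hf : ∀ n, f μ S n ≤ 1 := fun n => prob_le_one
  have hu : ∀ n, u μ S n ≤ 1 := fun n => by
    rw [u_eq_measure_renewalEvent]
    exact prob_le_one
  have hsf := summable_toReal_mul_pow hf hz0 hz1
  have hsu := summable_toReal_mul_pow hu hz0 hz1
  have hu0 : u μ S 0 = 1 := if_pos rfl
  have hrec : ∀ n ≠ 0, (u μ S n).toReal * z ^ n = ∑ x ∈ Finset.HasAntidiagonal.antidiagonal n,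
      (f μ S x.1).toReal * z ^ x.1 * ((u μ S x.2).toReal * z ^ x.2) := by
    intro n hn
    rw [u_eq_sum_antidiagonal (w := fun c => if c then ENNReal.ofReal p else ENNReal.ofReal (1 - p))
      hμ S hn, ENNReal.toReal_sum fun x _ => ENNReal.mul_ne_top
        ((hf _).trans_lt one_lt_top).ne ((hu _).trans_lt one_lt_top).ne, Finset.sum_mul]
    refine Finset.sum_congr rfl fun x hx => ?_
    rw [← Finset.HasAntidiagonal.mem_antidiagonal.mp hx, ENNReal.toReal_mul, pow_add]
    ring
  have hmain : U μ S z - 1 = F μ S z * U μ S z := by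
    have hprod : F μ S z * U μ S z = ∑' n, ∑ x ∈ Finset.HasAntidiagonal.antidiagonal n,
        (f μ S x.1).toReal * z ^ x.1 * ((u μ S x.2).toReal * z ^ x.2) :=
      tsum_mul_tsum_eq_tsum_sum_antidiagonal_of_summable_norm hsf.norm hsu.norm
    have hsprod := (summable_norm_sum_mul_antidiagonal_of_summable_norm hsf.norm hsu.norm).of_norm
    rw [hprod, hsprod.tsum_eq_zero_add, U, hsu.tsum_eq_zero_add]
    simp only [hrec _ (Nat.succ_ne_zero _)]
    simp [hu0, f_zero μ hS]
  refine ⟨hmain, fun h => ?_⟩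
  rw [hmain, mul_div_cancel_right₀ _ (by linarith)]
end

section
/- The expected number of trials to generate pattern S for the first time is E[T_S] = ( Σ_{ℓ ∈ S⊡S} P_{s_{ℓ+1}⋯s_k} ) / P_S, equivalently E[T_S] = Σ_{ℓ ∈ S⊡S} 1 / P_{s₁⋯s_ℓ}. -/
open MeasureTheory ENNReal

/-- `P_W = p^{#H} q^{#T}`, the probability of generating the string `W`. -/
def strProb (p : ℝ) (W : List Bool) : ℝ :=
  p ^ W.count true * (1 - p) ^ W.count false

/-- The overlap set `S ⊡ W`. -/
def overlaps (S W : List Bool) : Finset ℕ :=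
  (Finset.Icc 1 (min S.length W.length)).filter fun i => S.drop (S.length - i) = W.take i

theorem strProb_pos {p : ℝ} (hp0 : 0 < p) (hp1 : p < 1) (W : List Bool) : 0 < strProb p W :=
  mul_pos (pow_pos hp0 _) (pow_pos (sub_pos.2 hp1) _)

theorem strProb_append (p : ℝ) (U W : List Bool) :
    strProb p (U ++ W) = strProb p U * strProb p W := by
  simp only [strProb, List.count_append, pow_add]
  ring

theorem prod_range_eq_strProb {p : ℝ} (hp0 : 0 < p) (hp1 : p < 1) (W : List Bool) :
    ∏ i ∈ Finset.range W.length,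
      (if W.getD i false then ENNReal.ofReal p else ENNReal.ofReal (1 - p))
        = ENNReal.ofReal (strProb p W) := by
  induction W with
  | nil => simp [strProb]
  | cons a W ih =>
    have h : strProb p (a :: W) = strProb p W * (if a then p else 1 - p) := by
      cases a <;> simp [strProb, pow_succ] <;> ring
    rw [List.length_cons, Finset.prod_range_succ', h,
      ENNReal.ofReal_mul (strProb_pos hp0 hp1 W).le, ← ih]
    cases a <;> simp

theorem mem_overlaps_self_iff (S : List Bool) (i : ℕ) :
    i ∈ overlaps S S ↔ 1 ≤ i ∧ i ≤ S.length ∧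
      ∀ j < i, S.getD (S.length - i + j) false = S.getD j false := by
  simp only [overlaps, Finset.mem_filter, Finset.mem_Icc, min_self, and_assoc]
  refine and_congr_right fun _ => and_congr_right fun hi => ⟨fun h j hj => ?_, fun h => ?_⟩
  · have h' := congrArg (fun L => L.getD j false) h
    simpa [List.getD_eq_getElem?_getD, List.getElem?_drop, List.getElem?_take, hj] using h'
  · refine List.ext_getElem (by simp; omega) fun j h₁ h₂ => ?_
    simp only [List.length_take] at h₂
    have hj := h j (by omega)
    rw [List.getD_eq_getElem _ _ (by omega), List.getD_eq_getElem _ _ (by omega)] at hj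
    simpa using hj

theorem lt_firstOcc_iff {S : List Bool} {ω : ℕ → Bool} {n : ℕ} :
    (n : ℕ∞) < firstOcc S ω ↔ ∀ m ≤ n, ¬ occursAt S ω m := by
  constructor
  · intro h m hm ho
    have : firstOcc S ω ≤ m := iInf₂_le m ho
    exact absurd (h.trans_le this) (by simpa using hm)
  · intro h
    have : ((n + 1 : ℕ) : ℕ∞) ≤ firstOcc S ω := by
      refine le_iInf₂ fun m ho => ?_
      have : ¬ m ≤ n := fun hm => h m hm ho
      exact_mod_cast (by omega : n + 1 ≤ m)
    exact lt_of_lt_of_le (by exact_mod_cast n.lt_succ_self) this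

theorem firstOcc_eq_iff {S : List Bool} {ω : ℕ → Bool} {n : ℕ} :
    firstOcc S ω = n ↔ occursAt S ω n ∧ ∀ m < n, ¬ occursAt S ω m := by
  constructor
  · intro h
    have hlt : ∀ m < n, ¬ occursAt S ω m := by
      intro m hm
      exact lt_firstOcc_iff.1 (h ▸ Nat.cast_lt.2 hm) m le_rfl
    refine ⟨by_contra fun hn => ?_, hlt⟩
    have : (n : ℕ∞) < firstOcc S ω := lt_firstOcc_iff.2 fun m hm => by
      rcases hm.lt_or_eq with hm | rfl
      exacts [hlt m hm, hn]
    exact this.ne' h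
  · rintro ⟨hn, hlt⟩
    refine le_antisymm (iInf₂_le n hn) (le_iInf₂ fun m ho => ?_)
    have : ¬ m < n := fun hm => hlt m hm ho
    exact_mod_cast not_lt.1 this

theorem length_le_firstOcc (S : List Bool) (ω : ℕ → Bool) : (S.length : ℕ∞) ≤ firstOcc S ω :=
  le_iInf₂ fun _ h => by exact_mod_cast h.1

/-- If `S` is generated in the `|S|` trials following a time `n` before its first occurrence,
then the first occurrence is at time `n + i` for some `i` in the overlap set of `S`. -/
theorem lt_firstOcc_and_block_iff {S : List Bool} {ω : ℕ → Bool} {n : ℕ} :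
    ((n : ℕ∞) < firstOcc S ω ∧ ∀ j < S.length, ω (n + j) = S.getD j false) ↔
      ∃ i ∈ overlaps S S, firstOcc S ω = (n + i : ℕ) ∧
        ∀ j < (S.drop i).length, ω (n + i + j) = (S.drop i).getD j false := by
  have hdrop : ∀ i j, (S.drop i).getD j false = S.getD (i + j) false := by
    intro i j
    simp [List.getD_eq_getElem?_getD]
  simp only [hdrop, mem_overlaps_self_iff, List.length_drop]
  constructor
  · rintro ⟨hn, hS⟩
    have hocc : occursAt S ω (n + S.length) := ⟨by omega, fun j hj => by
      rw [← hS j hj]; congr 1; omega⟩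
    have hle : firstOcc S ω ≤ (n + S.length : ℕ) := iInf₂_le _ hocc
    obtain ⟨N, hN⟩ := ENat.ne_top_iff_exists.1 (ne_top_of_le_ne_top (ENat.natCast_ne_top _) hle)
    rw [← hN] at hn hle
    have hn' : n < N := by exact_mod_cast hn
    have hle' : N ≤ n + S.length := by exact_mod_cast hle
    obtain ⟨hkN, hocN⟩ := (firstOcc_eq_iff.1 hN.symm).1
    refine ⟨N - n, ⟨by omega, by omega, fun j hj => ?_⟩, ?_, fun j hj => ?_⟩
    · rw [← hocN _ (by omega), ← hS j (by omega)]
      congr 1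
      omega
    · rw [← hN, Nat.add_sub_cancel' hn'.le]
    · rw [← hS _ (by omega), add_assoc]
  · rintro ⟨i, ⟨hi1, hik, hov⟩, hT, hi⟩
    refine ⟨by rw [hT]; exact_mod_cast (by omega : n < n + i), fun j hj => ?_⟩
    obtain ⟨hk, hoc⟩ := (firstOcc_eq_iff.1 hT).1
    by_cases hji : j < i
    · rw [← hov j hji, ← hoc _ (by omega)]
      congr 1
      omega
    · have := hi (j - i) (by omega)
      rwa [show n + i + (j - i) = n + j by omega, show i + (j - i) = j by omega] at this

theorem ENat.toENNReal_eq_tsum (t : ℕ∞) :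
    (t : ℝ≥0∞) = ∑' n : ℕ, if (n : ℕ∞) < t then 1 else 0 := by
  induction t using ENat.recTopCoe with
  | top => simp
  | coe N =>
    rw [tsum_eq_sum (s := Finset.range N) fun n hn => by simpa using hn,
      Finset.sum_congr rfl (g := fun _ => 1) fun n hn => by simpa using hn]
    simp

/-- `F` depends on the coordinates before `n` only. -/
def DependsBefore (n : ℕ) (F : Set (ℕ → Bool)) : Prop :=
  ∀ ω ω' : ℕ → Bool, (∀ i < n, ω i = ω' i) → (ω ∈ F ↔ ω' ∈ F)

theorem DependsBefore.measurableSet {n : ℕ} {F : Set (ℕ → Bool)} (hF : DependsBefore n F) :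
    MeasurableSet F := by
  have hr : Measurable fun (ω : ℕ → Bool) (i : Fin n) => ω i := by fun_prop
  have : F = (fun (ω : ℕ → Bool) (i : Fin n) => ω i) ⁻¹'
      ((fun (ω : ℕ → Bool) (i : Fin n) => ω i) '' F) := by
    refine (Set.subset_preimage_image _ _).antisymm ?_
    rintro ω ⟨ω', hω', h⟩
    exact (hF _ _ fun i hi => congrFun h ⟨i, hi⟩).1 hω'
  rw [this]
  exact hr (Set.toFinite _).measurableSet

theorem dependsBefore_lt_firstOcc (S : List Bool) (n : ℕ) :
    DependsBefore n {ω | (n : ℕ∞) < firstOcc S ω} := by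
  intro ω ω' h
  simp only [Set.mem_ofPred_eq, lt_firstOcc_iff]
  exact forall₂_congr fun m hm => not_congr (occursAt_congr fun i hi => h i (by omega))

theorem dependsBefore_firstOcc_eq (S : List Bool) (n : ℕ) :
    DependsBefore n {ω | firstOcc S ω = n} := by
  intro ω ω' h
  simp only [Set.mem_ofPred_eq, firstOcc_eq_iff]
  exact and_congr (occursAt_congr h)
    (forall₂_congr fun m hm => not_congr (occursAt_congr fun i hi => h i (by omega)))

theorem dependsBefore_block (W : List Bool) (n : ℕ) :
    DependsBefore (n + W.length) {ω | ∀ j < W.length, ω (n + j) = W.getD j false} := by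
  intro ω ω' h
  refine forall₂_congr fun j hj => ?_
  rw [h _ (by omega)]

theorem measure_inter_block {p : ℝ} (hp0 : 0 < p) (hp1 : p < 1) (μ : Measure (ℕ → Bool))
    (hμ : ∀ (n : ℕ) (b : ℕ → Bool),
      μ {ω | ∀ i < n, ω i = b i}
        = ∏ i ∈ Finset.range n, (if b i then ENNReal.ofReal p else ENNReal.ofReal (1 - p)))
    {n : ℕ} {F : Set (ℕ → Bool)} (hF : DependsBefore n F) (W : List Bool) :
    μ (F ∩ {ω | ∀ j < W.length, ω (n + j) = W.getD j false})
      = μ F * ENNReal.ofReal (strProb p W) := by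
  let r : (ℕ → Bool) → Fin n → Bool := fun ω i => ω i
  have hr : Measurable r := by fun_prop
  have hsum : ∀ A : Set (ℕ → Bool), μ A = ∑ v, μ (r ⁻¹' {v} ∩ A) := by
    intro A
    have h := sum_measure_preimage_singleton (μ := μ.restrict A) Finset.univ (f := r)
      fun v _ => hr (measurableSet_singleton v)
    simp only [Finset.coe_univ, Set.preimage_univ, Measure.restrict_apply_univ] at h
    rw [← h]
    exact Finset.sum_congr rfl fun v _ =>
      Measure.restrict_apply (hr (measurableSet_singleton v))
  rw [hsum, hsum F, Finset.sum_mul]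
  refine Finset.sum_congr rfl fun v _ => ?_
  let b : ℕ → Bool := fun i => if h : i < n then v ⟨i, h⟩ else W.getD (i - n) false
  have hv : ∀ ω, r ω = v ↔ ∀ i < n, ω i = b i := by
    intro ω
    rw [funext_iff, Fin.forall_iff]
    refine forall₂_congr fun i hi => ?_
    simp [r, b, hi]
  by_cases hb : b ∈ F
  · have hvF : r ⁻¹' {v} ⊆ F := fun ω hω => (hF ω b ((hv ω).1 hω)).2 hb
    rw [← Set.inter_assoc, Set.inter_eq_left.2 hvF]
    have h₁ : r ⁻¹' {v} = {ω | ∀ i < n, ω i = b i} := Set.ext hv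
    have h₂ : r ⁻¹' {v} ∩ {ω | ∀ j < W.length, ω (n + j) = W.getD j false}
        = {ω | ∀ i < n + W.length, ω i = b i} := by
      rw [h₁]
      ext ω
      simp only [Set.mem_inter_iff, Set.mem_ofPred_eq]
      constructor
      · rintro ⟨h, h'⟩ i hi
        by_cases hin : i < n
        · exact h i hin
        · have := h' (i - n) (by omega)
          rw [Nat.add_sub_cancel' (not_lt.1 hin)] at this
          simp only [b, hin, dite_false, this]
      · refine fun h => ⟨fun i hi => h i (by omega), fun j hj => ?_⟩
        rw [h _ (by omega)]
        simp [b]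
    rw [h₂, h₁, hμ, hμ, Finset.prod_range_add, ← prod_range_eq_strProb hp0 hp1]
    simp [b]
  · have hvF : r ⁻¹' {v} ∩ F = ∅ := by
      ext ω
      simp only [Set.mem_inter_iff, Set.mem_empty_iff_false, iff_false, not_and]
      exact fun hω h => hb ((hF ω b ((hv ω).1 hω)).1 h)
    rw [← Set.inter_assoc, hvF]
    simp

theorem measure_lt_firstOcc_mul {p : ℝ} (hp0 : 0 < p) (hp1 : p < 1) (μ : Measure (ℕ → Bool))
    (hμ : ∀ (n : ℕ) (b : ℕ → Bool),
      μ {ω | ∀ i < n, ω i = b i}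
        = ∏ i ∈ Finset.range n, (if b i then ENNReal.ofReal p else ENNReal.ofReal (1 - p)))
    (S : List Bool) (n : ℕ) :
    μ {ω | (n : ℕ∞) < firstOcc S ω} * ENNReal.ofReal (strProb p S)
      = ∑ i ∈ overlaps S S,
          μ {ω | firstOcc S ω = (n + i : ℕ)} * ENNReal.ofReal (strProb p (S.drop i)) := by
  have hunion : {ω | (n : ℕ∞) < firstOcc S ω} ∩ {ω | ∀ j < S.length, ω (n + j) = S.getD j false}
      = ⋃ i ∈ overlaps S S, {ω | firstOcc S ω = (n + i : ℕ)} ∩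
          {ω | ∀ j < (S.drop i).length, ω (n + i + j) = (S.drop i).getD j false} := by
    ext ω
    rw [Set.mem_iUnion₂]
    refine lt_firstOcc_and_block_iff.trans ?_
    simp only [exists_prop, Set.mem_inter_iff, Set.mem_ofPred_eq]
  rw [← measure_inter_block hp0 hp1 μ hμ (dependsBefore_lt_firstOcc S n), hunion,
    measure_biUnion_finset]
  · exact Finset.sum_congr rfl fun i _ =>
      measure_inter_block hp0 hp1 μ hμ (dependsBefore_firstOcc_eq S (n + i)) _
  · intro i _ j _ hij
    refine Set.disjoint_left.2 fun ω hi hj => hij ?_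
    have h := hi.1.symm.trans hj.1
    exact Nat.add_left_cancel (ENat.natCast_inj.1 h)
  · exact fun i _ => (dependsBefore_firstOcc_eq S (n + i)).measurableSet.inter
      (dependsBefore_block _ _).measurableSet

theorem lintegral_firstOcc (μ : Measure (ℕ → Bool)) (S : List Bool) :
    ∫⁻ ω, (firstOcc S ω : ℝ≥0∞) ∂μ = ∑' n : ℕ, μ {ω | (n : ℕ∞) < firstOcc S ω} := by
  have hm := fun n => (dependsBefore_lt_firstOcc S n).measurableSet
  have h : ∀ ω, (firstOcc S ω : ℝ≥0∞)
      = ∑' n : ℕ, {ω | (n : ℕ∞) < firstOcc S ω}.indicator (fun _ => 1) ω := fun ω => by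
    rw [ENat.toENNReal_eq_tsum]
    simp only [Set.indicator_apply, Set.mem_ofPred_eq]
  simp_rw [h]
  rw [lintegral_tsum fun n => (measurable_const.indicator (hm n)).aemeasurable]
  simp_rw [lintegral_indicator_const (hm _), one_mul]

theorem tsum_measure_firstOcc_eq (μ : Measure (ℕ → Bool)) (S : List Bool) {i : ℕ}
    (hi : i ≤ S.length) :
    ∑' n : ℕ, μ {ω | firstOcc S ω = (n + i : ℕ)} = μ {ω | firstOcc S ω ≠ ⊤} := by
  rw [← measure_iUnion _ fun n => (dependsBefore_firstOcc_eq S (n + i)).measurableSet]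
  · congr 1
    ext ω
    simp only [Set.mem_iUnion, Set.mem_ofPred_eq]
    constructor
    · rintro ⟨n, hn⟩
      rw [hn]
      exact ENat.natCast_ne_top _
    · intro h
      obtain ⟨N, hN⟩ := ENat.ne_top_iff_exists.1 h
      have hle := length_le_firstOcc S ω
      rw [← hN] at hle
      have hle' : S.length ≤ N := by exact_mod_cast hle
      exact ⟨N - i, by rw [← hN, Nat.sub_add_cancel (hi.trans hle')]⟩
  · intro m n hmn
    refine Set.disjoint_left.2 fun ω hm hn => hmn ?_
    have h := hm.symm.trans hn
    exact Nat.add_right_cancel (ENat.natCast_inj.1 h)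

theorem lintegral_firstOcc_mul {p : ℝ} (hp0 : 0 < p) (hp1 : p < 1) (μ : Measure (ℕ → Bool))
    (hμ : ∀ (n : ℕ) (b : ℕ → Bool),
      μ {ω | ∀ i < n, ω i = b i}
        = ∏ i ∈ Finset.range n, (if b i then ENNReal.ofReal p else ENNReal.ofReal (1 - p)))
    (S : List Bool) :
    (∫⁻ ω, (firstOcc S ω : ℝ≥0∞) ∂μ) * ENNReal.ofReal (strProb p S)
      = μ {ω | firstOcc S ω ≠ ⊤} *
          ENNReal.ofReal (∑ i ∈ overlaps S S, strProb p (S.drop i)) := by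
  rw [lintegral_firstOcc, ← ENNReal.tsum_mul_right]
  simp_rw [measure_lt_firstOcc_mul hp0 hp1 μ hμ]
  rw [Summable.tsum_finsetSum fun _ _ => ENNReal.summable,
    ENNReal.ofReal_sum_of_nonneg fun i _ => (strProb_pos hp0 hp1 _).le, Finset.mul_sum]
  refine Finset.sum_congr rfl fun i hi => ?_
  rw [ENNReal.tsum_mul_right, tsum_measure_firstOcc_eq μ S ((mem_overlaps_self_iff S i).1 hi).2.1]

theorem measurable_firstOcc (S : List Bool) :
    Measurable fun ω => (firstOcc S ω : ℝ≥0∞) := by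
  simp_rw [ENat.toENNReal_eq_tsum]
  exact Measurable.tsum fun n =>
    Measurable.ite (dependsBefore_lt_firstOcc S n).measurableSet measurable_const measurable_const

theorem stmt5 (p : ℝ) (hp0 : 0 < p) (hp1 : p < 1)
    (μ : Measure (ℕ → Bool)) [IsProbabilityMeasure μ]
    (hμ : ∀ (n : ℕ) (b : ℕ → Bool),
      μ {ω | ∀ i < n, ω i = b i}
        = ∏ i ∈ Finset.range n, (if b i then ENNReal.ofReal p else ENNReal.ofReal (1 - p)))
    (S : List Bool) (hS : S ≠ []) :
    ∫⁻ ω, (firstOcc S ω : ℝ≥0∞) ∂μ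
        = ENNReal.ofReal ((∑ ℓ ∈ overlaps S S, strProb p (S.drop ℓ)) / strProb p S) ∧
    ∫⁻ ω, (firstOcc S ω : ℝ≥0∞) ∂μ
        = ENNReal.ofReal (∑ ℓ ∈ overlaps S S, 1 / strProb p (S.take ℓ)) := by
  have hpos := strProb_pos hp0 hp1
  have hP0 : ENNReal.ofReal (strProb p S) ≠ 0 := (ENNReal.ofReal_pos.2 (hpos S)).ne'
  have hmul := lintegral_firstOcc_mul hp0 hp1 μ hμ S
  have hfin : ∫⁻ ω, (firstOcc S ω : ℝ≥0∞) ∂μ ≠ ∞ := by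
    intro h
    rw [h, ENNReal.top_mul hP0] at hmul
    exact ENNReal.mul_ne_top (measure_ne_top _ _) ENNReal.ofReal_ne_top hmul.symm
  have hone : μ {ω | firstOcc S ω ≠ ⊤} = 1 := by
    have hae : ∀ᵐ ω ∂μ, firstOcc S ω ≠ ⊤ := by
      filter_upwards [ae_lt_top (measurable_firstOcc S) hfin] with ω hω h
      simp [h] at hω
    rw [measure_congr (Filter.eventuallyEq_univ.2 hae), measure_univ]
  have hfirst : ∫⁻ ω, (firstOcc S ω : ℝ≥0∞) ∂μ
      = ENNReal.ofReal ((∑ ℓ ∈ overlaps S S, strProb p (S.drop ℓ)) / strProb p S) := by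
    rw [ENNReal.ofReal_div_of_pos (hpos S), ENNReal.eq_div_iff hP0 ENNReal.ofReal_ne_top,
      mul_comm, hmul, hone, one_mul]
  refine ⟨hfirst, hfirst.trans ?_⟩
  rw [Finset.sum_div]
  congr 1
  refine Finset.sum_congr rfl fun ℓ _ => ?_
  have h := strProb_append p (S.take ℓ) (S.drop ℓ)
  rw [List.take_append_drop] at h
  rw [h, div_eq_div_iff (mul_pos (hpos _) (hpos _)).ne' (hpos _).ne']
  ring
end

section
/- For the pattern S = TTHTTTTHT (length 9), the probability that S is generated for the first time in exactly 18 trials is f_{18} = p²q⁷ · (1 − pq⁴ − p²q⁶ − p²q⁷). -/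
open MeasureTheory ENNReal

theorem firstOcc_eq_coe_iff (S : List Bool) (ω : ℕ → Bool) (n : ℕ) :
    firstOcc S ω = (n : ℕ∞) ↔ occursAt S ω n ∧ ∀ m < n, ¬ occursAt S ω m := by
  unfold firstOcc
  constructor
  · intro h
    have hlow : ∀ m < n, ¬ occursAt S ω m := by
      intro m hm ho
      have hle := iInf₂_le (f := fun (k : ℕ) (_ : occursAt S ω k) => (k : ℕ∞)) m ho
      rw [h] at hle
      exact absurd (by exact_mod_cast hle) (not_le.mpr hm)
    refine ⟨?_, hlow⟩
    by_contra hn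
    have hle : ((n + 1 : ℕ) : ℕ∞) ≤ ⨅ (k : ℕ) (_ : occursAt S ω k), (k : ℕ∞) := by
      refine le_iInf₂ fun k hk => ?_
      have hnk : n + 1 ≤ k := by
        by_contra hlt
        rcases Nat.lt_or_eq_of_le (show k ≤ n by omega) with h1 | h1
        · exact hlow k h1 hk
        · exact hn (h1 ▸ hk)
      exact_mod_cast hnk
    rw [h] at hle
    have : n + 1 ≤ n := by exact_mod_cast hle
    omega
  · rintro ⟨ho, hlow⟩
    refine le_antisymm (iInf₂_le n ho) (le_iInf₂ fun k hk => ?_)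
    have : n ≤ k := not_lt.mp fun hlt => hlow k hlt hk
    exact_mod_cast this

/-- The sequences that agree with `b` on the window `[m, n)`. -/
def windowCylinder (m n : ℕ) (b : ℕ → Bool) : Set (ℕ → Bool) :=
  {ω | ∀ i < n, m ≤ i → ω i = b i}

theorem measurableSet_windowCylinder (m n : ℕ) (b : ℕ → Bool) :
    MeasurableSet (windowCylinder m n b) := by
  have : windowCylinder m n b = ⋂ (i : ℕ) (_ : i < n) (_ : m ≤ i), {ω | ω i = b i} := by
    ext ω
    simp [windowCylinder]
  rw [this]
  exact .iInter fun i => .iInter fun _ => .iInter fun _ =>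
    measurableSet_eq_fun (measurable_pi_apply i) measurable_const

theorem windowCylinder_succ (m n : ℕ) (hm : m < n) (b : ℕ → Bool) :
    windowCylinder (m + 1) n b = windowCylinder m n (Function.update b m true) ∪
      windowCylinder m n (Function.update b m false) := by
  ext ω
  have key : ∀ c, ω ∈ windowCylinder m n (Function.update b m c) ↔
      ω m = c ∧ ω ∈ windowCylinder (m + 1) n b := by
    intro c
    constructor
    · intro h
      refine ⟨by simpa using h m hm le_rfl, fun i hi hmi => ?_⟩
      have := h i hi (by omega)
      rwa [Function.update_of_ne (by omega)] at this
    · rintro ⟨h1, h2⟩ i hi hmi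
      rcases eq_or_ne i m with rfl | hne
      · simpa using h1
      · rw [Function.update_of_ne hne]
        exact h2 i hi (by omega)
  rw [Set.mem_union, key, key]
  cases ω m <;> simp

theorem measure_windowCylinder (μ : Measure (ℕ → Bool)) (w : Bool → ℝ≥0∞)
    (hw : w true + w false = 1)
    (hμ : ∀ (n : ℕ) (b : ℕ → Bool), μ {ω | ∀ i < n, ω i = b i} = ∏ i ∈ Finset.range n, w (b i))
    (m n : ℕ) (hmn : m ≤ n) (b : ℕ → Bool) :
    μ (windowCylinder m n b) = ∏ i ∈ Finset.Ico m n, w (b i) := by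
  induction m generalizing b with
  | zero => simpa [windowCylinder] using hμ n b
  | succ m ih =>
    have hupd : ∀ c, ∏ i ∈ Finset.Ico m n, w (Function.update b m c i) =
        w c * ∏ i ∈ Finset.Ico (m + 1) n, w (b i) := by
      intro c
      rw [Finset.prod_eq_prod_Ico_succ_bot (by omega)]
      congr 1
      · simp
      · refine Finset.prod_congr rfl fun i hi => ?_
        rw [Function.update_of_ne (by have := Finset.mem_Ico.mp hi; omega)]
    rw [windowCylinder_succ m n (by omega), measure_union _ (measurableSet_windowCylinder ..),
      ih (by omega), ih (by omega), hupd, hupd, ← add_mul, hw, one_mul]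
    refine Set.disjoint_left.mpr fun ω h1 h2 => ?_
    have e1 := h1 m (by omega) le_rfl
    have e2 := h2 m (by omega) le_rfl
    simp_all

/-- The word with the pattern TTHTTTTHT at positions `9, …, 17` (and tails before). -/
def wordEnd : List Bool :=
  [false, false, false, false, false, false, false, false, false,
    false, false, true, false, false, false, false, true, false]

/-- The word with the pattern at positions `4, …, 12` and `9, …, 17`. -/
def wordOverlapFour : List Bool :=
  [false, false, false, false, false, false, true, false, false,
    false, false, true, false, false, false, false, true, false]

/-- The word with the pattern at positions `1, …, 9` and `9, …, 17`. -/
def wordOverlapOne : List Bool :=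
  [false, false, false, true, false, false, false, false, true,
    false, false, true, false, false, false, false, true, false]

/-- The word with the pattern at positions `0, …, 8` and `9, …, 17`. -/
def wordTwice : List Bool :=
  [false, false, true, false, false, false, false, true, false,
    false, false, true, false, false, false, false, true, false]

theorem setOf_firstOcc_eq_diff :
    {ω | firstOcc [false, false, true, false, false, false, false, true, false] ω
        = ((18 : ℕ) : ℕ∞)} =
      windowCylinder 9 18 (wordEnd.getD · false) \
        (windowCylinder 4 18 (wordOverlapFour.getD · false) ∪
          (windowCylinder 1 18 (wordOverlapOne.getD · false) ∪
            windowCylinder 0 18 (wordTwice.getD · false))) := by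
  ext ω
  rw [Set.mem_ofPred_eq, firstOcc_eq_coe_iff]
  simp only [windowCylinder, occursAt, wordEnd, wordOverlapFour, wordOverlapOne, wordTwice,
    Set.mem_sdiff, Set.mem_union, Set.mem_ofPred_eq,
    List.length_cons, List.length_nil, Nat.forall_lt_succ_right, Nat.not_lt_zero,
    false_imp_iff, implies_true, true_and]
  norm_num
  grind

theorem stmt6 (p : ℝ) (hp0 : 0 < p) (hp1 : p < 1)
    (μ : Measure (ℕ → Bool)) [IsProbabilityMeasure μ]
    (hμ : ∀ (n : ℕ) (b : ℕ → Bool),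
      μ {ω | ∀ i < n, ω i = b i}
        = ∏ i ∈ Finset.range n, (if b i then ENNReal.ofReal p else ENNReal.ofReal (1 - p))) :
    f μ [false, false, true, false, false, false, false, true, false] 18
      = ENNReal.ofReal (p ^ 2 * (1 - p) ^ 7 *
          (1 - p * (1 - p) ^ 4 - p ^ 2 * (1 - p) ^ 6 - p ^ 2 * (1 - p) ^ 7)) := by
  have hq : 0 ≤ 1 - p := by linarith
  have hw : ENNReal.ofReal p + ENNReal.ofReal (1 - p) = 1 := by
    rw [← ENNReal.ofReal_add hp0.le hq]
    simp
  have hcyl : ∀ m ≤ 18, ∀ b : ℕ → Bool, μ (windowCylinder m 18 b) =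
      ENNReal.ofReal (∏ i ∈ Finset.Ico m 18, if b i then p else 1 - p) := by
    intro m hm b
    rw [measure_windowCylinder μ (fun c => if c then ENNReal.ofReal p else ENNReal.ofReal (1 - p))
      (by simpa using hw) hμ m 18 hm b, ENNReal.ofReal_prod_of_nonneg]
    · exact Finset.prod_congr rfl fun i _ => by split_ifs <;> rfl
    · intro i _
      split_ifs <;> linarith
  have h9 : μ (windowCylinder 9 18 (wordEnd.getD · false)) =
      ENNReal.ofReal (p ^ 2 * (1 - p) ^ 7) := by
    rw [hcyl 9 (by norm_num)]
    congr 1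
    simp [Finset.prod_Ico_eq_prod_range, Finset.prod_range_succ, wordEnd]
    ring
  have h4 : μ (windowCylinder 4 18 (wordOverlapFour.getD · false)) =
      ENNReal.ofReal (p ^ 3 * (1 - p) ^ 11) := by
    rw [hcyl 4 (by norm_num)]
    congr 1
    simp [Finset.prod_Ico_eq_prod_range, Finset.prod_range_succ, wordOverlapFour]
    ring
  have h1 : μ (windowCylinder 1 18 (wordOverlapOne.getD · false)) =
      ENNReal.ofReal (p ^ 4 * (1 - p) ^ 13) := by
    rw [hcyl 1 (by norm_num)]
    congr 1
    simp [Finset.prod_Ico_eq_prod_range, Finset.prod_range_succ, wordOverlapOne]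
    ring
  have h0 : μ (windowCylinder 0 18 (wordTwice.getD · false)) =
      ENNReal.ofReal (p ^ 4 * (1 - p) ^ 14) := by
    rw [hcyl 0 (by norm_num)]
    congr 1
    simp [Finset.prod_range_succ, wordTwice]
    ring
  have d10 : Disjoint (windowCylinder 1 18 (wordOverlapOne.getD · false))
      (windowCylinder 0 18 (wordTwice.getD · false)) := by
    refine Set.disjoint_left.mpr fun ω ha hb => ?_
    have ea := ha 2 (by norm_num) (by norm_num)
    have eb := hb 2 (by norm_num) (by norm_num)
    simp [wordOverlapOne, wordTwice] at ea eb
    simp_all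
  have d4 : Disjoint (windowCylinder 4 18 (wordOverlapFour.getD · false))
      (windowCylinder 1 18 (wordOverlapOne.getD · false) ∪
        windowCylinder 0 18 (wordTwice.getD · false)) := by
    refine Set.disjoint_left.mpr fun ω ha hb => ?_
    have e7 := ha 7 (by norm_num) (by norm_num)
    have e8 := ha 8 (by norm_num) (by norm_num)
    rcases hb with hb | hb
    · have eb := hb 8 (by norm_num) (by norm_num)
      simp [wordOverlapOne, wordOverlapFour] at e8 eb
      simp_all
    · have eb := hb 7 (by norm_num) (by norm_num)
      simp [wordTwice, wordOverlapFour] at e7 eb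
      simp_all
  have hsub : windowCylinder 4 18 (wordOverlapFour.getD · false) ∪
      (windowCylinder 1 18 (wordOverlapOne.getD · false) ∪
        windowCylinder 0 18 (wordTwice.getD · false)) ⊆
      windowCylinder 9 18 (wordEnd.getD · false) := by
    rintro ω (h | h | h) i hi hmi <;> rw [h i hi (by omega)] <;> interval_cases i <;> rfl
  have hmeas := measurableSet_windowCylinder
  rw [f, setOf_firstOcc_eq_diff,
    measure_sdiff hsub ((hmeas ..).union ((hmeas ..).union (hmeas ..))).nullMeasurableSet
      (measure_ne_top _ _),
    measure_union d4 ((hmeas ..).union (hmeas ..)), measure_union d10 (hmeas ..), h9, h4, h1, h0,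
    ← ENNReal.ofReal_add (by positivity) (by positivity),
    ← ENNReal.ofReal_add (by positivity) (by positivity),
    ← ENNReal.ofReal_sub _ (by positivity)]
  congr 1
  ring
end

section
/- The game terminates almost surely: Σ_{i=1}^{m} Σ_{n≥1} x_{i,n} = 1, i.e. with probability 1 exactly one of the patterns S_1, …, S_m wins at some finite trial. -/
open MeasureTheory ENNReal

/-- Pattern `i` wins the game at trial `n`. -/
def winsAt {m : ℕ} (S : Fin m → List Bool) (i : Fin m) (ω : ℕ → Bool) (n : ℕ) : Prop :=
  occursAt (S i) ω n ∧ ∀ j : Fin m, ∀ l < n, ¬ occursAt (S j) ω l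

noncomputable def x {m : ℕ} (μ : Measure (ℕ → Bool)) (S : Fin m → List Bool)
    (i : Fin m) (n : ℕ) : ℝ≥0∞ :=
  μ {ω | winsAt S i ω n}

/-- The event that the symbols at positions `n, n + 1, …` spell the pattern `S`. -/
def blockAt (S : List Bool) (n : ℕ) : Set (ℕ → Bool) :=
  {ω | ∀ j < S.length, ω (n + j) = S.getD j false}

lemma measurableSet_blockAt (S : List Bool) (n : ℕ) : MeasurableSet (blockAt S n) := by
  have : blockAt S n = ⋂ j, ⋂ (_ : j < S.length), {ω | ω (n + j) = S.getD j false} := by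
    ext ω; simp [blockAt]
  rw [this]
  exact .iInter fun j => .iInter fun _ =>
    measurableSet_eq_fun (measurable_pi_apply _) measurable_const

lemma occursAt_iff (S : List Bool) (ω : ℕ → Bool) (n : ℕ) :
    occursAt S ω n ↔ S.length ≤ n ∧ ω ∈ blockAt S (n - S.length) := Iff.rfl

lemma measurableSet_occursAt (S : List Bool) (n : ℕ) : MeasurableSet {ω | occursAt S ω n} :=
  (MeasurableSet.const (S.length ≤ n)).inter (measurableSet_blockAt S (n - S.length))

lemma measurableSet_winsAt {m : ℕ} (S : Fin m → List Bool) (i : Fin m) (n : ℕ) :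
    MeasurableSet {ω | winsAt S i ω n} := by
  have : {ω | winsAt S i ω n} =
      {ω | occursAt (S i) ω n} ∩ ⋂ j, ⋂ l, ⋂ (_ : l < n), {ω | occursAt (S j) ω l}ᶜ := by
    ext ω; simp [winsAt]
  rw [this]
  exact (measurableSet_occursAt _ _).inter <|
    .iInter fun j => .iInter fun l => .iInter fun _ => (measurableSet_occursAt _ _).compl

/-- Of two patterns ending at the same trial, the shorter is a suffix of the longer. -/
lemma occursAt.isSuffix {S T : List Bool} {ω : ℕ → Bool} {n : ℕ} (hS : occursAt S ω n)
    (hT : occursAt T ω n) (hle : S.length ≤ T.length) : S <:+ T := by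
  rw [List.suffix_iff_eq_drop]
  apply List.ext_getElem
  · simp; omega
  · intro j h1 h2
    have a := hS.2 j h1
    have b := hT.2 (T.length - S.length + j) (by omega)
    have hT1 := hT.1
    rw [show n - T.length + (T.length - S.length + j) = n - S.length + j by omega, a] at b
    rw [List.getD_eq_getElem _ _ h1, List.getD_eq_getElem _ _ (by omega)] at b
    simpa using b

/-- An event on the first `n` symbols is independent of the block starting at position `n`. -/
lemma measure_preimage_inter_blockAt (μ : Measure (ℕ → Bool)) [IsProbabilityMeasure μ]
    (w : Bool → ℝ≥0∞)
    (hμ : ∀ (n : ℕ) (b : ℕ → Bool), μ {ω | ∀ i < n, ω i = b i} = ∏ i ∈ Finset.range n, w (b i))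
    (S : List Bool) (n : ℕ) (A : Set (Fin n → Bool)) :
    μ ((fun ω (i : Fin n) => ω i) ⁻¹' A ∩ blockAt S n)
      = (∏ j ∈ Finset.range S.length, w (S.getD j false)) *
        μ ((fun ω (i : Fin n) => ω i) ⁻¹' A) := by
  have hr : Measurable fun (ω : ℕ → Bool) (i : Fin n) => ω i :=
    measurable_pi_lambda _ fun i => measurable_pi_apply _
  have key : (μ.restrict (blockAt S n)).map (fun ω (i : Fin n) => ω i)
      = (∏ j ∈ Finset.range S.length, w (S.getD j false)) •
        μ.map (fun ω (i : Fin n) => ω i) := by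
    refine Measure.ext_of_singleton fun b => ?_
    rw [Measure.map_apply hr (measurableSet_singleton b),
      Measure.restrict_apply (hr (measurableSet_singleton b)), Measure.smul_apply,
      Measure.map_apply hr (measurableSet_singleton b), smul_eq_mul]
    let b' : ℕ → Bool := fun i => if h : i < n then b ⟨i, h⟩ else S.getD (i - n) false
    have h1 : (fun (ω : ℕ → Bool) (i : Fin n) => ω i) ⁻¹' {b} = {ω | ∀ i < n, ω i = b' i} := by
      ext ω
      simp only [Set.mem_preimage, Set.mem_singleton_iff, Set.mem_ofPred_eq, funext_iff]
      constructor
      · intro h i hi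
        simpa [b', hi] using h ⟨i, hi⟩
      · intro h i
        simpa [b'] using h i i.2
    have h2 : {ω | ∀ i < n, ω i = b' i} ∩ blockAt S n =
        {ω | ∀ i < n + S.length, ω i = b' i} := by
      ext ω
      simp only [Set.mem_inter_iff, Set.mem_ofPred_eq, blockAt]
      constructor
      · rintro ⟨h, h'⟩ i hi
        by_cases hin : i < n
        · exact h i hin
        · have := h' (i - n) (by omega)
          rw [show n + (i - n) = i by omega] at this
          simp only [b', hin, dite_false, this]
      · refine fun h => ⟨fun i hi => h i (by omega), fun j hj => ?_⟩
        have := h (n + j) (by omega)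
        simpa [b'] using this
    rw [h1, h2, hμ, hμ, Finset.prod_range_add, mul_comm]
    congr 1
    refine Finset.prod_congr rfl fun j _ => ?_
    simp [b']
  have := congrArg (fun ν => ν A) key
  have hA : MeasurableSet A := A.toFinite.measurableSet
  simpa [Measure.map_apply hr hA, Measure.restrict_apply (hr hA)] using this

/-- The event that none of the first `k` consecutive blocks of length `|S|` spells `S`. -/
def noBlock (S : List Bool) (k : ℕ) : Set (ℕ → Bool) :=
  {ω | ∀ t < k, ω ∉ blockAt S (t * S.length)}

lemma exists_noBlock_eq_preimage (S : List Bool) (k : ℕ) :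
    ∃ A : Set (Fin (k * S.length) → Bool),
      noBlock S k = (fun ω (i : Fin (k * S.length)) => ω i) ⁻¹' A := by
  refine ⟨(fun b i => if h : i < k * S.length then b ⟨i, h⟩ else false) ⁻¹' noBlock S k, ?_⟩
  ext ω
  simp only [noBlock, blockAt, Set.mem_preimage, Set.mem_ofPred_eq]
  refine forall₂_congr fun t ht => not_congr <| forall₂_congr fun j hj => ?_
  have : t * S.length + j < k * S.length := by
    have := Nat.mul_le_mul_right S.length (Nat.succ_le_of_lt ht)
    rw [Nat.succ_mul] at this
    omega
  simp [this]

lemma measure_noBlock (μ : Measure (ℕ → Bool)) [IsProbabilityMeasure μ] (w : Bool → ℝ≥0∞)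
    (hμ : ∀ (n : ℕ) (b : ℕ → Bool), μ {ω | ∀ i < n, ω i = b i} = ∏ i ∈ Finset.range n, w (b i))
    (S : List Bool) (k : ℕ) :
    μ (noBlock S k) = (1 - ∏ j ∈ Finset.range S.length, w (S.getD j false)) ^ k := by
  induction k with
  | zero => simp [noBlock]
  | succ k ih =>
    have hstep : noBlock S (k + 1) = noBlock S k \ (noBlock S k ∩ blockAt S (k * S.length)) := by
      ext ω
      simp only [noBlock, Set.sdiff_self_inter, Set.mem_sdiff, Set.mem_ofPred_eq]
      exact Nat.forall_lt_succ_right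
    have hmeas : MeasurableSet (noBlock S k) := by
      have : noBlock S k = ⋂ t, ⋂ (_ : t < k), (blockAt S (t * S.length))ᶜ := by
        ext ω; simp [noBlock]
      rw [this]
      exact .iInter fun t => .iInter fun _ => (measurableSet_blockAt _ _).compl
    obtain ⟨A, hA⟩ := exists_noBlock_eq_preimage S k
    have hind := measure_preimage_inter_blockAt μ w hμ S (k * S.length) A
    rw [← hA] at hind
    rw [hstep, measure_sdiff Set.inter_subset_left
      (hmeas.inter (measurableSet_blockAt _ _)).nullMeasurableSet (measure_ne_top _ _), hind,
      pow_succ', ← ih, ENNReal.sub_mul fun _ _ => measure_ne_top _ _, one_mul]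

/-- Almost surely, a pattern all of whose symbols have positive weight occurs. -/
lemma ae_exists_occursAt (μ : Measure (ℕ → Bool)) [IsProbabilityMeasure μ] (w : Bool → ℝ≥0∞)
    (hw : ∀ a, w a ≠ 0)
    (hμ : ∀ (n : ℕ) (b : ℕ → Bool), μ {ω | ∀ i < n, ω i = b i} = ∏ i ∈ Finset.range n, w (b i))
    (S : List Bool) : ∀ᵐ ω ∂μ, ∃ n, occursAt S ω n := by
  have hc : 1 - ∏ j ∈ Finset.range S.length, w (S.getD j false) < 1 :=
    ENNReal.sub_lt_self one_ne_top one_ne_zero (Finset.prod_ne_zero_iff.2 fun _ _ => hw _)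
  rw [ae_iff]
  refine le_antisymm (ge_of_tendsto' (ENNReal.tendsto_pow_atTop_nhds_zero_of_lt_one hc)
    fun k => ?_) zero_le
  rw [← measure_noBlock μ w hμ S k]
  refine measure_mono fun ω hω t _ hb => hω ⟨t * S.length + S.length, ?_⟩
  simpa [occursAt_iff] using hb

/-- Once some pattern occurs, some pattern wins. -/
lemma exists_winsAt {m : ℕ} (S : Fin m → List Bool) {ω : ℕ → Bool}
    (h : ∃ n i, occursAt (S i) ω n) : ∃ i n, winsAt S i ω n := by
  classical
  obtain ⟨i, hi⟩ := Nat.find_spec h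
  exact ⟨i, Nat.find h, hi, fun j l hl hj => Nat.find_min h hl ⟨j, hj⟩⟩

/-- At most one pattern wins, and at only one trial. -/
lemma winsAt_unique {m : ℕ} {S : Fin m → List Bool} (hsub : ∀ i j, i ≠ j → ¬ S i <:+: S j)
    {ω : ℕ → Bool} {i j : Fin m} {n l : ℕ} (hi : winsAt S i ω n) (hj : winsAt S j ω l) :
    i = j ∧ n = l := by
  obtain rfl : n = l := by
    rcases lt_trichotomy n l with h | h | h
    · exact absurd hi.1 (hj.2 i n h)
    · exact h
    · exact absurd hj.1 (hi.2 j l h)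
  refine ⟨?_, rfl⟩
  by_contra hne
  rcases le_total (S i).length (S j).length with h | h
  · exact hsub i j hne (hi.1.isSuffix hj.1 h).isInfix
  · exact hsub j i (Ne.symm hne) (hj.1.isSuffix hi.1 h).isInfix

theorem stmt11 (p : ℝ) (hp0 : 0 < p) (hp1 : p < 1)
    (μ : Measure (ℕ → Bool)) [IsProbabilityMeasure μ]
    (hμ : ∀ (n : ℕ) (b : ℕ → Bool),
      μ {ω | ∀ i < n, ω i = b i}
        = ∏ i ∈ Finset.range n, (if b i then ENNReal.ofReal p else ENNReal.ofReal (1 - p)))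
    (m : ℕ) (hm : 1 ≤ m) (S : Fin m → List Bool) (hS : ∀ i, S i ≠ [])
    (hsub : ∀ i j, i ≠ j → ¬ S i <:+: S j) :
    ∑ i : Fin m, ∑' n : ℕ, x μ S i n = 1 := by
  have hw : ∀ a : Bool, (if a then ENNReal.ofReal p else ENNReal.ofReal (1 - p)) ≠ 0 := by
    intro a
    cases a <;> simp [hp0, hp1]
  have hae := ae_exists_occursAt μ _ hw hμ (S ⟨0, hm⟩)
  have hdisj : Pairwise
      (Function.onFun Disjoint fun a : Fin m × ℕ => {ω | winsAt S a.1 ω a.2}) := by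
    intro a b hab
    refine Set.disjoint_left.2 fun ω ha hb => hab ?_
    obtain ⟨h1, h2⟩ := winsAt_unique hsub ha hb
    exact Prod.ext h1 h2
  rw [← tsum_fintype (L := .unconditional _), ← ENNReal.tsum_prod]
  simp only [x]
  rw [← measure_iUnion hdisj fun a => measurableSet_winsAt S a.1 a.2, ← measure_univ (μ := μ)]
  refine measure_congr (Filter.eventuallyEq_univ.2 ?_)
  filter_upwards [hae] with ω ⟨n, hn⟩
  obtain ⟨i, l, hil⟩ := exists_winsAt S ⟨n, _, hn⟩
  exact Set.mem_iUnion.2 ⟨(i, l), hil⟩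
end

section
/- In the game between S₁ = TTTHTTT and S₂ = TTHTTTTHT, the expected duration of the game (the expected trial at which the first of the two patterns is completed) equals (1 + q³(1 − q³) + p³q⁶ + p²(1 + p)q⁹) / ( pq⁶ (1 + p²q − p³q³) ). -/
open MeasureTheory ENNReal

/-- The duration of the game between `S₁` and `S₂`: the least `n` such that
`S₁` or `S₂` occurs ending at trial `n` (`⊤` if neither ever occurs). -/
noncomputable def duration (S₁ S₂ : List Bool) (ω : ℕ → Bool) : ℕ∞ :=
  ⨅ (n : ℕ) (_ : occursAt S₁ ω n ∨ occursAt S₂ ω n), (n : ℕ∞)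

/-! ### Occurrences of patterns -/

theorem occursAt.append_singleton {S : List Bool} {ω : ℕ → Bool} {n : ℕ}
    (h : occursAt S ω n) : occursAt (S ++ [ω n]) ω (n + 1) := by
  obtain ⟨hn, h⟩ := h
  refine ⟨by simpa using hn, fun j hj => ?_⟩
  simp only [List.length_append, List.length_singleton] at hj ⊢
  rcases Nat.lt_succ_iff_lt_or_eq.1 hj with hj | rfl
  · rw [List.getD_append _ _ _ _ hj, ← h j hj]
    congr 1
    omega
  · rw [List.getD_append_right _ _ _ _ le_rfl, Nat.sub_self, List.getD_cons_zero]
    congr 1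
    omega

theorem occursAt.of_suffix {S S' : List Bool} {ω : ℕ → Bool} {n : ℕ}
    (h : occursAt S ω n) (hS : S' <:+ S) : occursAt S' ω n := by
  obtain ⟨u, rfl⟩ := hS
  obtain ⟨hn, h⟩ := h
  rw [List.length_append] at hn h
  refine ⟨by omega, fun j hj => ?_⟩
  have := h (u.length + j) (by omega)
  rw [List.getD_append_right _ _ _ _ (by omega), Nat.add_sub_cancel_left] at this
  rw [← this]
  congr 1
  omega

/-! ### Automata driven by the trials -/

section Automaton

variable {σ : Type*} (δ : σ → Bool → σ) (s₀ : σ)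

/-- The state of the automaton with transition function `δ` and initial state `s₀`
after reading the first `n` trials of `ω`. -/
def stateAfter (ω : ℕ → Bool) : ℕ → σ
  | 0 => s₀
  | n + 1 => δ (stateAfter ω n) (ω n)

theorem stateAfter_congr {ω ω' : ℕ → Bool} {n : ℕ} (h : ∀ i < n, ω i = ω' i) :
    stateAfter δ s₀ ω n = stateAfter δ s₀ ω' n := by
  induction n with
  | zero => rfl
  | succ n ih =>
    rw [stateAfter, stateAfter, ih fun i hi => h i (by omega), h n (by omega)]

theorem stateAfter_add_length (ω : ℕ → Bool) (S : List Bool) (m : ℕ)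
    (h : ∀ j < S.length, ω (m + j) = S.getD j false) :
    stateAfter δ s₀ ω (m + S.length) = S.foldl δ (stateAfter δ s₀ ω m) := by
  induction S generalizing m with
  | nil => rfl
  | cons c S ih =>
    have h0 : ω m = c := by simpa using h 0 (by simp)
    have := ih (m + 1) fun j hj => by
      have := h (j + 1) (by simpa using hj)
      rw [List.getD_cons_succ] at this
      rw [← this]
      congr 1
      omega
    rw [List.foldl_cons, List.length_cons, ← h0]
    rw [show m + (S.length + 1) = m + 1 + S.length by omega, this]
    rfl

theorem occursAt.stateAfter_eq {S : List Bool} {ω : ℕ → Bool} {n : ℕ} (h : occursAt S ω n) :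
    stateAfter δ s₀ ω n = S.foldl δ (stateAfter δ s₀ ω (n - S.length)) := by
  rw [← stateAfter_add_length δ s₀ ω S _ h.2, Nat.sub_add_cancel h.1]

theorem stateAfter_eq_of_le {a : σ} (ha : ∀ c, δ a c = a) {ω : ℕ → Bool} {m n : ℕ}
    (hmn : m ≤ n) (h : stateAfter δ s₀ ω m = a) : stateAfter δ s₀ ω n = a := by
  induction n, hmn using Nat.le_induction with
  | base => exact h
  | succ n _ ih => rw [stateAfter, ih, ha]

/-- If state `a` is absorbing, is reached by reading either pattern from any state, and every
other state remembers a suffix of the trials read, so that `a` is entered only on completion of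
a pattern, then the duration counts the trials before absorption. -/
theorem duration_eq_tsum {S₁ S₂ : List Bool} (a : σ) (w : σ → List Bool)
    (ha : ∀ c, δ a c = a) (hs₀ : s₀ ≠ a) (hw₀ : w s₀ = [])
    (hS₁ : ∀ s, S₁.foldl δ s = a) (hS₂ : ∀ s, S₂.foldl δ s = a)
    (hw : ∀ s c, s ≠ a → δ s c ≠ a → w (δ s c) <:+ w s ++ [c])
    (hwa : ∀ s c, s ≠ a → δ s c = a → S₁ <:+ w s ++ [c] ∨ S₂ <:+ w s ++ [c])
    (ω : ℕ → Bool) :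
    (duration S₁ S₂ ω : ℝ≥0∞) =
      ∑' n, {ω | stateAfter δ s₀ ω n ≠ a}.indicator (fun _ => (1 : ℝ≥0∞)) ω := by
  have hocc : ∀ n, occursAt S₁ ω n ∨ occursAt S₂ ω n → stateAfter δ s₀ ω n = a := by
    rintro n (h | h)
    · rw [h.stateAfter_eq δ s₀, hS₁]
    · rw [h.stateAfter_eq δ s₀, hS₂]
  have hword : ∀ n, stateAfter δ s₀ ω n ≠ a → occursAt (w (stateAfter δ s₀ ω n)) ω n := by
    intro n
    induction n with
    | zero =>
      intro _
      rw [stateAfter, hw₀]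
      exact ⟨le_rfl, by simp⟩
    | succ n ih =>
      intro hn
      have hn' : stateAfter δ s₀ ω n ≠ a := fun h =>
        hn (stateAfter_eq_of_le δ s₀ ha n.le_succ h)
      exact (ih hn').append_singleton.of_suffix (hw _ _ hn' hn)
  have hfirst : ∀ n, stateAfter δ s₀ ω n = a → ∃ m ≤ n, occursAt S₁ ω m ∨ occursAt S₂ ω m := by
    intro n
    induction n with
    | zero => exact fun h => absurd h hs₀
    | succ n ih =>
      intro hn
      by_cases hn' : stateAfter δ s₀ ω n = a
      · obtain ⟨m, hm, h⟩ := ih hn'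
        exact ⟨m, by omega, h⟩
      · have := (hword n hn').append_singleton
        exact ⟨n + 1, le_rfl, (hwa _ _ hn' hn).imp this.of_suffix this.of_suffix⟩
  by_cases hD : ∃ n, stateAfter δ s₀ ω n = a
  · classical
    have hlt : ∀ n, stateAfter δ s₀ ω n ≠ a ↔ n < Nat.find hD := fun n => by
      rw [Nat.lt_find_iff]
      exact ⟨fun h m hm h' => h (stateAfter_eq_of_le δ s₀ ha hm h'), fun h => h n le_rfl⟩
    have hdur : duration S₁ S₂ ω = (Nat.find hD : ℕ∞) := by
      refine le_antisymm ?_ (le_iInf₂ fun n hn => ?_)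
      · obtain ⟨m, hm, h⟩ := hfirst _ (Nat.find_spec hD)
        exact (iInf₂_le m h).trans (by exact_mod_cast hm)
      · exact_mod_cast Nat.find_min' hD (hocc n hn)
    rw [hdur, tsum_eq_sum (s := Finset.range (Nat.find hD))]
    · rw [Finset.sum_congr rfl fun n hn => Set.indicator_of_mem
        (show ω ∈ {ω | stateAfter δ s₀ ω n ≠ a} from (hlt n).2 (Finset.mem_range.1 hn)) _]
      simp
    · intro n hn
      exact Set.indicator_of_notMem (fun h => hn (Finset.mem_range.2 ((hlt n).1 h))) _
  · push Not at hD
    have hdur : duration S₁ S₂ ω = ⊤ := by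
      simp only [duration, iInf_eq_top]
      exact fun n hn => absurd (hocc n hn) (hD n)
    rw [hdur, tsum_congr fun n => Set.indicator_of_mem
      (show ω ∈ {ω | stateAfter δ s₀ ω n ≠ a} from hD n) _]
    simp

theorem measurable_stateAfter [MeasurableSpace σ] [Finite σ] [MeasurableSingletonClass σ] (n : ℕ) :
    Measurable fun ω => stateAfter δ s₀ ω n := by
  induction n with
  | zero => exact measurable_const
  | succ n ih =>
    exact (Measurable.of_discrete (f := fun x : σ × Bool => δ x.1 x.2)).comp
      (ih.prodMk (measurable_pi_apply n))

end Automaton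

/-! ### Independent trials -/

section Trials

variable {p : ℝ} {μ : Measure (ℕ → Bool)}

theorem measure_inter_next
    (hμ : ∀ (n : ℕ) (b : ℕ → Bool),
      μ {ω | ∀ i < n, ω i = b i}
        = ∏ i ∈ Finset.range n, (if b i then ENNReal.ofReal p else ENNReal.ofReal (1 - p)))
    (n : ℕ) (A : Set (ℕ → Bool))
    (hA : ∀ ω ω' : ℕ → Bool, (∀ i < n, ω i = ω' i) → ω ∈ A → ω' ∈ A) (c : Bool) :
    μ (A ∩ {ω | ω n = c})
      = (if c then ENNReal.ofReal p else ENNReal.ofReal (1 - p)) * μ A := by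
  classical
  let f : (ℕ → Bool) → Fin n → Bool := fun ω i => ω i
  have hf : Measurable f := measurable_pi_lambda _ fun i => measurable_pi_apply _
  let B : Finset (Fin n → Bool) := Finset.univ.filter (· ∈ f '' A)
  have hB : f ⁻¹' (B : Set (Fin n → Bool)) = A := by
    ext ω
    simp only [B, Finset.coe_filter, Finset.mem_univ, true_and, Set.mem_preimage,
      Set.mem_ofPred_eq, Set.mem_image]
    refine ⟨?_, fun h => ⟨ω, h, rfl⟩⟩
    rintro ⟨ω', h, he⟩
    exact hA ω' ω (fun i hi => congrFun he ⟨i, hi⟩) h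
  have hc : MeasurableSet {ω : ℕ → Bool | ω n = c} :=
    measurableSet_eq_fun (measurable_pi_apply n) measurable_const
  have key : ∀ b : Fin n → Bool, μ.restrict {ω | ω n = c} (f ⁻¹' {b})
      = (if c then ENNReal.ofReal p else ENNReal.ofReal (1 - p)) * μ (f ⁻¹' {b}) := by
    intro b
    rw [Measure.restrict_apply (hf (measurableSet_singleton b))]
    let b' : ℕ → Bool := fun i => if h : i < n then b ⟨i, h⟩ else c
    have hb : ∀ ω, f ω = b ↔ ∀ i < n, ω i = b' i := fun ω => by
      rw [funext_iff]
      refine ⟨fun h i hi => ?_, fun h i => ?_⟩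
      · simpa [b', hi] using h ⟨i, hi⟩
      · simpa [b', i.2] using h i i.2
    have hbn : b' n = c := by simp [b']
    have h1 : f ⁻¹' {b} = {ω | ∀ i < n, ω i = b' i} := Set.ext hb
    have h2 : f ⁻¹' {b} ∩ {ω | ω n = c} = {ω | ∀ i < n + 1, ω i = b' i} := by
      ext ω
      rw [h1]
      simp only [Set.mem_inter_iff, Set.mem_ofPred_eq, Nat.forall_lt_succ_right, hbn]
    rw [h2, h1, hμ, hμ, Finset.prod_range_succ, hbn, mul_comm]
  have hr : μ (A ∩ {ω | ω n = c}) = μ.restrict {ω | ω n = c} A := (Measure.restrict_apply' hc).symm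
  rw [hr, ← hB, ← sum_measure_preimage_singleton B fun b _ => hf (measurableSet_singleton b),
    ← sum_measure_preimage_singleton B fun b _ => hf (measurableSet_singleton b), Finset.mul_sum]
  exact Finset.sum_congr rfl fun b _ => key b

variable {σ : Type*} [Fintype σ] [DecidableEq σ] (δ : σ → Bool → σ) (s₀ : σ)

theorem sum_mul_measureReal_stateAfter_succ [IsFiniteMeasure μ] (hp0 : 0 ≤ p) (hp1 : p ≤ 1)
    (hμ : ∀ (n : ℕ) (b : ℕ → Bool),
      μ {ω | ∀ i < n, ω i = b i}
        = ∏ i ∈ Finset.range n, (if b i then ENNReal.ofReal p else ENNReal.ofReal (1 - p)))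
    (h : σ → ℝ) (n : ℕ) :
    ∑ s, μ.real {ω | stateAfter δ s₀ ω (n + 1) = s} * h s =
      ∑ s, μ.real {ω | stateAfter δ s₀ ω n = s} *
        (p * h (δ s true) + (1 - p) * h (δ s false)) := by
  let _ : MeasurableSpace σ := ⊤
  have hmeas := measurable_stateAfter δ s₀ n
  have hnext : ∀ s c, μ.real ({ω | stateAfter δ s₀ ω n = s} ∩ {ω | ω n = c})
      = (if c then p else 1 - p) * μ.real {ω | stateAfter δ s₀ ω n = s} := fun s c => by
    rw [measureReal_def, measure_inter_next hμ n _ _ c, ENNReal.toReal_mul, ← measureReal_def]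
    · cases c
      · simp [ENNReal.toReal_ofReal (sub_nonneg.2 hp1)]
      · simp [ENNReal.toReal_ofReal hp0]
    · intro ω ω' hω hs
      rw [Set.mem_ofPred_eq, ← stateAfter_congr δ s₀ hω]
      exact hs
  have hsplit : ∀ t, μ.real {ω | stateAfter δ s₀ ω (n + 1) = t} =
      ∑ x : σ × Bool, if δ x.1 x.2 = t then
        (if x.2 then p else 1 - p) * μ.real {ω | stateAfter δ s₀ ω n = x.1} else 0 := fun t => by
    let g : (ℕ → Bool) → σ × Bool := fun ω => (stateAfter δ s₀ ω n, ω n)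
    have hg : Measurable g := hmeas.prodMk (measurable_pi_apply n)
    have hpre : {ω | stateAfter δ s₀ ω (n + 1) = t} =
        g ⁻¹' ((Finset.univ.filter fun x : σ × Bool => δ x.1 x.2 = t : Finset (σ × Bool)) :
          Set (σ × Bool)) := by
      ext ω
      simp [g, stateAfter]
    rw [hpre, ← Finset.sum_filter, measureReal_def,
      ← sum_measure_preimage_singleton _ fun x _ => hg (measurableSet_singleton x),
      ENNReal.toReal_sum fun x _ => measure_ne_top _ _]
    refine Finset.sum_congr rfl fun x _ => ?_
    rw [← hnext, measureReal_def]
    congr 2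
    ext ω
    simp [g, Prod.ext_iff]
  simp_rw [hsplit, Finset.sum_mul, ite_mul, zero_mul]
  rw [Finset.sum_comm]
  simp only [Finset.sum_ite_eq, Finset.mem_univ, if_true]
  rw [Fintype.sum_prod_type]
  refine Finset.sum_congr rfl fun s _ => ?_
  simp only [Fintype.sum_bool, if_true, Bool.false_eq_true, if_false]
  ring

/-- A solution `h` of the first-step equations, vanishing at the absorbing state `a`, gives the
expected time to absorption. -/
theorem tsum_measure_stateAfter_ne [IsProbabilityMeasure μ] (hp0 : 0 ≤ p) (hp1 : p ≤ 1)
    (hμ : ∀ (n : ℕ) (b : ℕ → Bool),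
      μ {ω | ∀ i < n, ω i = b i}
        = ∏ i ∈ Finset.range n, (if b i then ENNReal.ofReal p else ENNReal.ofReal (1 - p)))
    (a : σ) (ha : ∀ c, δ a c = a) (h : σ → ℝ) (hha : h a = 0)
    (hh : ∀ s, s ≠ a → h s = 1 + p * h (δ s true) + (1 - p) * h (δ s false)) :
    ∑' n, μ {ω | stateAfter δ s₀ ω n ≠ a} = ENNReal.ofReal (h s₀) := by
  let _ : MeasurableSpace σ := ⊤
  let P : ℕ → σ → ℝ := fun n s => μ.real {ω | stateAfter δ s₀ ω n = s}
  let u : ℕ → ℝ := fun n => μ.real {ω | stateAfter δ s₀ ω n ≠ a}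
  have hu0 : ∀ n, 0 ≤ u n := fun n => measureReal_nonneg
  have hu : ∀ n, u n = ∑ s ∈ Finset.univ.erase a, P n s := fun n => by
    have hpre : {ω | stateAfter δ s₀ ω n ≠ a} = (fun ω => stateAfter δ s₀ ω n) ⁻¹'
        ((Finset.univ.erase a : Finset σ) : Set σ) := by
      ext ω
      simp
    simp only [u, P]
    rw [hpre, measureReal_def, ← sum_measure_preimage_singleton _ fun s _ =>
      measurable_stateAfter δ s₀ n (measurableSet_singleton s),
      ENNReal.toReal_sum fun x _ => measure_ne_top _ _]
    rfl
  have hE : ∀ n, ∑ s, P n s * h s = ∑ s ∈ Finset.univ.erase a, P n s * h s := fun n => by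
    rw [← Finset.add_sum_erase _ _ (Finset.mem_univ a), hha, mul_zero, zero_add]
  have hstep : ∀ n, ∑ s, P (n + 1) s * h s = ∑ s, P n s * h s - u n := fun n => by
    rw [sum_mul_measureReal_stateAfter_succ δ s₀ hp0 hp1 hμ h n, hE, hu,
      ← Finset.sum_sub_distrib, ← Finset.add_sum_erase _ _ (Finset.mem_univ a), ha, ha, hha]
    simp only [mul_zero, add_zero, zero_add]
    refine Finset.sum_congr rfl fun s hs => ?_
    rw [hh s (Finset.ne_of_mem_erase hs)]
    ring
  have hsum : ∀ n, ∑ k ∈ Finset.range n, u k = h s₀ - ∑ s, P n s * h s := fun n => by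
    induction n with
    | zero =>
      have : ∀ s, P 0 s = if s₀ = s then 1 else 0 := fun s => by
        by_cases hs : s₀ = s <;> simp [P, stateAfter, hs]
      simp [this]
    | succ n ih => rw [Finset.sum_range_succ, ih, hstep]; ring
  have hbound : ∀ n, |∑ s, P n s * h s| ≤ u n * ∑ s, |h s| := fun n => by
    rw [hE, hu, Finset.sum_mul]
    refine (Finset.abs_sum_le_sum_abs _ _).trans (Finset.sum_le_sum fun s _ => ?_)
    rw [abs_mul, abs_of_nonneg (show 0 ≤ P n s from measureReal_nonneg)]
    exact mul_le_mul_of_nonneg_left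
      (Finset.single_le_sum (f := fun s => |h s|) (fun _ _ => abs_nonneg _) (Finset.mem_univ s))
      measureReal_nonneg
  have hsummable : Summable u := by
    refine summable_of_sum_range_le (c := h s₀ + ∑ s, |h s|) hu0 fun n => ?_
    have h1 := neg_le_of_abs_le (hbound n)
    have h2 : u n * ∑ s, |h s| ≤ 1 * ∑ s, |h s| :=
      mul_le_mul_of_nonneg_right measureReal_le_one (Finset.sum_nonneg fun _ _ => abs_nonneg _)
    rw [hsum]
    linarith
  have hlim : Filter.Tendsto (fun n => ∑ s, P n s * h s) Filter.atTop (nhds 0) :=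
    squeeze_zero_norm hbound (by simpa using hsummable.tendsto_atTop_zero.mul_const (∑ s, |h s|))
  have hhas : HasSum u (h s₀) := by
    rw [hsummable.hasSum_iff_tendsto_nat]
    simp_rw [hsum]
    simpa using hlim.const_sub (h s₀)
  rw [← hhas.tsum_eq, ENNReal.ofReal_tsum_of_nonneg hu0 hsummable]
  exact tsum_congr fun n => (ofReal_measureReal).symm

end Trials

/-! ### The game between `TTTHTTT` and `TTHTTTTHT` -/

/-- The transitions of the automaton recognizing `TTTHTTT` and `TTHTTTTHT`; state `13` is
reached when one of the patterns is completed. -/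
def gameStep (s : Fin 14) (c : Bool) : Fin 14 :=
  if c then ![0, 0, 3, 0, 6, 0, 0, 3, 0, 6, 3, 12, 0, 13] s
  else ![1, 2, 4, 5, 4, 7, 8, 9, 10, 11, 13, 4, 13, 13] s

/-- The progress towards the patterns that each state of the automaton remembers. -/
def gameWord : Fin 14 → List Bool :=
  ![[], [false], [false, false], [false, false, true], [false, false, false],
    [false, false, true, false], [false, false, false, true],
    [false, false, true, false, false], [false, false, false, true, false],
    [false, false, true, false, false, false], [false, false, false, true, false, false],
    [false, false, true, false, false, false, false],
    [false, false, true, false, false, false, false, true], []]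

theorem exists_firstStep_solution {p : ℝ} (hp0 : 0 < p) (hp1 : p < 1) :
    ∃ h : Fin 14 → ℝ, h 13 = 0 ∧
      h 0 = (1 + (1 - p) ^ 3 * (1 - (1 - p) ^ 3) + p ^ 3 * (1 - p) ^ 6 +
              p ^ 2 * (1 + p) * (1 - p) ^ 9) /
            (p * (1 - p) ^ 6 * (1 + p ^ 2 * (1 - p) - p ^ 3 * (1 - p) ^ 3)) ∧
      ∀ s, s ≠ 13 → h s = 1 + p * h (gameStep s true) + (1 - p) * h (gameStep s false) := by
  obtain ⟨q, hq⟩ : ∃ q, q = 1 - p := ⟨_, rfl⟩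
  have hq0 : 0 < q := by linarith
  have hpq : p = 1 - q := by linarith
  rw [← hq]
  obtain ⟨d, hd⟩ : ∃ d, d = 1 + p ^ 2 * q - p ^ 3 * q ^ 3 := ⟨_, rfl⟩
  rw [← hd]
  have hd0 : d ≠ 0 := by
    have h1 : p ^ 3 * q ^ 3 < 1 := by
      rw [← mul_pow]
      exact pow_lt_one₀ (by positivity) (by nlinarith) (by norm_num)
    have h2 : 0 < p ^ 2 * q := by positivity
    linarith
  obtain ⟨E, hE⟩ : ∃ E, E = (1 + q ^ 3 * (1 - q ^ 3) + p ^ 3 * q ^ 6 + p ^ 2 * (1 + p) * q ^ 9) /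
    (p * q ^ 6 * d) := ⟨_, rfl⟩
  obtain ⟨A, hA⟩ : ∃ A, A =
    (E - 1 / q - 1 / q ^ 2 - 1 - q ^ 3 - q * (1 + q) * (1 + p * E) - q / p) /
      (p * (1 + q ^ 3)) := ⟨_, rfl⟩
  rw [← hE]
  let B := 1 + p * E + q * (1 + p * E + q * (1 + p * A))
  have h2 : E - 1 / q - 1 / q ^ 2 = 1 + p * A + q * (B + 1 / p) := by
    simp only [B]
    rw [hA]
    field_simp
    ring
  have h9 : (((A - 1 - p * E) / q - 1 - p * E) / q - 1 - p * A) / q =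
      1 + p * B + q * (1 + p * (1 + p * E) + q * (B + 1 / p)) := by
    simp only [B]
    rw [hA, hE]
    field_simp
    rw [hd, hpq]
    ring
  refine ⟨![E, E - 1 / q, E - 1 / q - 1 / q ^ 2, A, B + 1 / p, (A - 1 - p * E) / q, B,
    ((A - 1 - p * E) / q - 1 - p * E) / q, 1 + p * E + q * (1 + p * A),
    (((A - 1 - p * E) / q - 1 - p * E) / q - 1 - p * A) / q, 1 + p * A,
    1 + p * (1 + p * E) + q * (B + 1 / p), 1 + p * E, 0], rfl, rfl, fun s hs => ?_⟩
  fin_cases s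
  · change E = 1 + p * E + q * (E - 1 / q)
    field_simp
    rw [hpq]
    ring
  · change E - 1 / q = 1 + p * E + q * (E - 1 / q - 1 / q ^ 2)
    field_simp
    rw [hpq]
    ring
  · exact h2
  · change A = 1 + p * E + q * ((A - 1 - p * E) / q)
    field_simp
    ring
  · change B + 1 / p = 1 + p * B + q * (B + 1 / p)
    field_simp
    rw [hpq]
    ring
  · change (A - 1 - p * E) / q = 1 + p * E + q * (((A - 1 - p * E) / q - 1 - p * E) / q)
    field_simp
    ring
  · rfl
  · change ((A - 1 - p * E) / q - 1 - p * E) / q = 1 + p * A +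
      q * ((((A - 1 - p * E) / q - 1 - p * E) / q - 1 - p * A) / q)
    field_simp
    ring
  · rfl
  · exact h9
  · change 1 + p * A = 1 + p * A + q * 0
    ring
  · rfl
  · change 1 + p * E = 1 + p * E + q * 0
    ring
  · exact absurd rfl hs

theorem stmt14 (p : ℝ) (hp0 : 0 < p) (hp1 : p < 1)
    (μ : Measure (ℕ → Bool)) [IsProbabilityMeasure μ]
    (hμ : ∀ (n : ℕ) (b : ℕ → Bool),
      μ {ω | ∀ i < n, ω i = b i}
        = ∏ i ∈ Finset.range n, (if b i then ENNReal.ofReal p else ENNReal.ofReal (1 - p))) :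
    ∫⁻ ω, (duration [false, false, false, true, false, false, false]
            [false, false, true, false, false, false, false, true, false] ω : ℝ≥0∞) ∂μ
      = ENNReal.ofReal
          ((1 + (1 - p) ^ 3 * (1 - (1 - p) ^ 3) + p ^ 3 * (1 - p) ^ 6 +
              p ^ 2 * (1 + p) * (1 - p) ^ 9) /
            (p * (1 - p) ^ 6 * (1 + p ^ 2 * (1 - p) - p ^ 3 * (1 - p) ^ 3))) := by
  obtain ⟨h, hh13, hh0, hh⟩ := exists_firstStep_solution hp0 hp1
  have hmeas : ∀ n, MeasurableSet {ω | stateAfter gameStep 0 ω n ≠ 13} := fun n =>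
    (measurable_stateAfter gameStep 0 n (measurableSet_singleton 13)).compl
  rw [lintegral_congr (duration_eq_tsum (S₁ := [false, false, false, true, false, false, false])
    (S₂ := [false, false, true, false, false, false, false, true, false]) gameStep 0 13 gameWord
    (by decide) (by decide) (by decide) (by decide) (by decide) (by decide) (by decide)),
    lintegral_tsum fun n => (measurable_const.indicator (hmeas n)).aemeasurable]
  simp_rw [lintegral_indicator_const (hmeas _), one_mul]
  rw [tsum_measure_stateAfter_ne gameStep 0 hp0.le hp1.le hμ 13 (by decide) h hh13 hh, hh0]
end
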